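/- arXiv:2102.09128 — 6 statements merged into one kernel-verified Lean document; each statement's English description precedes it below -/
import Mathlib

section
/- Let k ≥ 2 and M > k be integers, let α > 0, let Ỹ_1,…,Ỹ_M be real numbers, and let y₀, y₁ ∈ ℝ. Among all functions f : [0,1] → ℝ that are k times continuously differentiable on [0,1] and satisfy f(0) = y₀ and f(1) = y₁, there exists exactly one function f_* such that Φ(f_*) ≤ Φ(f) for every such f. -/
open MeasureTheory Set

/-- The average of `f` over the `i`-th subinterval `[(i-1)/M, i/M]` of the uniform
partition of `[0,1]` into `M` pieces: `M_i(f) = (1/h_M) ∫_{x_{i-1}}^{x_i} f`. -/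
noncomputable def intervalAvg (M : ℕ) (f : ℝ → ℝ) (i : ℕ) : ℝ :=
  (M : ℝ) * ∫ x in (((i : ℝ) - 1) / M)..((i : ℝ) / M), f x

/-- The Tikhonov functional
`Φ(f) = (1/M) ∑_{i=1}^M (Ỹ_i − M_i(f))² + α ∫_0^1 (f^{(k)})²`. -/
noncomputable def tikhonov (M k : ℕ) (α : ℝ) (Ytil : ℕ → ℝ) (f : ℝ → ℝ) : ℝ :=
  (1 / M) * ∑ i ∈ Finset.Icc 1 M, (Ytil i - intervalAvg M f i) ^ 2
    + α * ∫ x in (0:ℝ)..1, (iteratedDerivWithin k f (Icc 0 1) x) ^ 2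

section BilinearForm

variable {V : Type*} [AddCommGroup V] [Module ℝ V]

/-- On a finite-dimensional space, a linear functional that vanishes on the isotropic vectors of
a bilinear form is represented by that form. -/
lemma exists_forall_apply_eq [FiniteDimensional ℝ V] (B : V →ₗ[ℝ] V →ₗ[ℝ] ℝ)
    (l : V →ₗ[ℝ] ℝ) (hl : ∀ x, B x x = 0 → l x = 0) :
    ∃ v, ∀ x, B v x = l x := by
  suffices l ∈ LinearMap.range B by
    obtain ⟨v, rfl⟩ := this
    exact ⟨v, fun _ ↦ rfl⟩
  by_contra hmem
  obtain ⟨φ, hφl, hφ⟩ := Submodule.exists_le_ker_of_notMem hmem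
  obtain ⟨w, rfl⟩ := (Module.evalEquiv ℝ V).surjective φ
  have hw : B w w = 0 := hφ ⟨w, rfl⟩
  exact hφl (hl w hw)

lemma exists_mem_forall_mem_apply_eq (B : V →ₗ[ℝ] V →ₗ[ℝ] ℝ)
    (W : Submodule ℝ V) [FiniteDimensional ℝ W] (l : V →ₗ[ℝ] ℝ)
    (hl : ∀ x ∈ W, B x x = 0 → l x = 0) :
    ∃ v ∈ W, ∀ x ∈ W, B v x = l x := by
  obtain ⟨v, hv⟩ := exists_forall_apply_eq (B.domRestrict₁₂ W W)
    (l.domRestrict W) (fun x hx ↦ hl x x.2 hx)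
  exact ⟨v, v.2, fun x hx ↦ hv ⟨x, hx⟩⟩

/-- Orthogonal projection onto a finite-dimensional subspace for a positive semidefinite form. -/
lemma exists_mem_forall_mem_apply_sub_eq_zero (B : V →ₗ[ℝ] V →ₗ[ℝ] ℝ)
    (hB : ∀ x y, B x y = B y x) (hpos : ∀ x, 0 ≤ B x x) (W : Submodule ℝ V)
    [FiniteDimensional ℝ W] (u : V) :
    ∃ s ∈ W, ∀ v ∈ W, B v (u - s) = 0 := by
  obtain ⟨s, hs, h⟩ := exists_mem_forall_mem_apply_eq B W (B u) fun x _ hx ↦ by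
    have := LinearMap.BilinForm.apply_mul_apply_le_of_forall_zero_le B hpos u x
    rw [hx, mul_zero, hB x u] at this
    nlinarith
  refine ⟨s, hs, fun v hv ↦ ?_⟩
  rw [map_sub, hB v u, hB v s, h v hv, sub_self]

end BilinearForm

section Primitive

/-- The operator `u ↦ ∫_0^x u`. -/
noncomputable def primitive : C(ℝ, ℝ) →ₗ[ℝ] C(ℝ, ℝ) where
  toFun u := ⟨fun x ↦ ∫ t in (0 : ℝ)..x, u t,
    intervalIntegral.continuous_primitive (fun _ _ ↦ u.continuous.intervalIntegrable _ _) 0⟩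
  map_add' u v := by
    ext x
    exact intervalIntegral.integral_add (u.continuous.intervalIntegrable _ _)
      (v.continuous.intervalIntegrable _ _)
  map_smul' c u := by
    ext x
    exact intervalIntegral.integral_smul c _

lemma primitive_apply (u : C(ℝ, ℝ)) (x : ℝ) : primitive u x = ∫ t in (0 : ℝ)..x, u t := rfl

lemma hasDerivAt_primitive (u : C(ℝ, ℝ)) (x : ℝ) : HasDerivAt (primitive u) (u x) x :=
  intervalIntegral.integral_hasDerivAt_right (u.continuous.intervalIntegrable _ _)
    (u.continuous.stronglyMeasurableAtFilter _ _) u.continuous.continuousAt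

lemma deriv_primitive (u : C(ℝ, ℝ)) : deriv (primitive u) = u :=
  funext fun x ↦ (hasDerivAt_primitive u x).deriv

lemma primitive_pow_succ_apply_zero (m : ℕ) (u : C(ℝ, ℝ)) : (primitive ^ (m + 1)) u 0 = 0 := by
  rw [pow_succ', Module.End.mul_apply, primitive_apply, intervalIntegral.integral_same]

lemma contDiff_primitive_pow (m : ℕ) (u : C(ℝ, ℝ)) : ContDiff ℝ m ((primitive ^ m) u) := by
  induction m with
  | zero => simpa using u.continuous
  | succ m ih =>
    rw [pow_succ', Module.End.mul_apply, Nat.cast_succ, contDiff_succ_iff_deriv, deriv_primitive]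
    exact ⟨fun x ↦ (hasDerivAt_primitive _ x).differentiableAt, by simp, ih⟩

lemma iteratedDeriv_primitive_pow (m : ℕ) (u : C(ℝ, ℝ)) :
    iteratedDeriv m ((primitive ^ m) u) = u := by
  induction m with
  | zero => simp
  | succ m ih =>
    rw [iteratedDeriv_succ', pow_succ', Module.End.mul_apply, deriv_primitive, ih]

/-- Cauchy's formula for repeated integration. -/
lemma primitive_pow_succ_apply (m : ℕ) (u : C(ℝ, ℝ)) (x : ℝ) :
    (primitive ^ (m + 1)) u x = ∫ t in (0 : ℝ)..x, (x - t) ^ m / (m.factorial : ℝ) * u t := by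
  induction m generalizing u with
  | zero => simp [primitive_apply]
  | succ m ih =>
    have hd : ∀ t : ℝ, HasDerivAt (fun t ↦ (x - t) ^ (m + 1) / ((m + 1).factorial : ℝ))
        (-((x - t) ^ m / (m.factorial : ℝ))) t := fun t ↦ by
      convert! (((hasDerivAt_id t).const_sub x).pow (m + 1)).div_const
        (((m + 1).factorial : ℕ) : ℝ) using 1
      have : (m.factorial : ℝ) ≠ 0 := by positivity
      rw [Nat.factorial_succ]
      push_cast
      field_simp
      simp
    have hc : Continuous fun t : ℝ ↦ -((x - t) ^ m / (m.factorial : ℝ)) := by fun_prop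
    rw [pow_succ, Module.End.mul_apply, ih,
      intervalIntegral.integral_mul_deriv_eq_deriv_mul (fun t _ ↦ hd t)
        (fun t _ ↦ hasDerivAt_primitive u t) (hc.intervalIntegrable _ _)
        (u.continuous.intervalIntegrable _ _)]
    simp [primitive_apply]

/-- Repeated integration followed by evaluation has a continuous kernel. -/
lemma exists_kernel_primitive_pow (m : ℕ) {x : ℝ} (hx : x ∈ Icc (0 : ℝ) 1) :
    ∃ K : C(ℝ, ℝ), ∀ u : C(ℝ, ℝ), (primitive ^ (m + 2)) u x = ∫ t in (0 : ℝ)..1, K t * u t := by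
  refine ⟨⟨fun t ↦ max (x - t) 0 ^ (m + 1) / ((m + 1).factorial : ℝ), by fun_prop⟩, fun u ↦ ?_⟩
  have hc : Continuous fun t ↦ max (x - t) 0 ^ (m + 1) / ((m + 1).factorial : ℝ) * u t := by
    fun_prop
  rw [primitive_pow_succ_apply]
  simp only [ContinuousMap.coe_mk]
  rw [← intervalIntegral.integral_add_adjacent_intervals (hc.intervalIntegrable 0 x)
    (hc.intervalIntegrable x 1)]
  have h₁ : ∫ t in x..1, max (x - t) 0 ^ (m + 1) / ((m + 1).factorial : ℝ) * u t = 0 := by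
    refine intervalIntegral.integral_zero_ae (Filter.Eventually.of_forall fun t ht ↦ ?_)
    rw [uIoc_of_le hx.2] at ht
    simp [max_eq_right (sub_nonpos.2 ht.1.le)]
  rw [h₁, add_zero]
  refine intervalIntegral.integral_congr fun t ht ↦ ?_
  rw [uIcc_of_le hx.1] at ht
  simp [max_eq_left (sub_nonneg.2 ht.2)]

end Primitive

/-- The `L²` inner product on `[0,1]`. -/
noncomputable def unitIntervalForm : C(ℝ, ℝ) →ₗ[ℝ] C(ℝ, ℝ) →ₗ[ℝ] ℝ :=
  LinearMap.mk₂ ℝ (fun u v ↦ ∫ t in (0 : ℝ)..1, u t * v t)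
    (fun u v w ↦ by
      rw [← intervalIntegral.integral_add (Continuous.intervalIntegrable (by fun_prop) _ _)
        (Continuous.intervalIntegrable (by fun_prop) _ _)]
      simp [add_mul])
    (fun c u v ↦ by simp [mul_assoc])
    (fun u v w ↦ by
      rw [← intervalIntegral.integral_add (Continuous.intervalIntegrable (by fun_prop) _ _)
        (Continuous.intervalIntegrable (by fun_prop) _ _)]
      simp [mul_add])
    (fun c u v ↦ by simp [mul_left_comm])

lemma unitIntervalForm_apply (u v : C(ℝ, ℝ)) :
    unitIntervalForm u v = ∫ t in (0 : ℝ)..1, u t * v t := rfl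

lemma unitIntervalForm_comm (u v : C(ℝ, ℝ)) : unitIntervalForm u v = unitIntervalForm v u := by
  simp only [unitIntervalForm_apply, mul_comm]

lemma unitIntervalForm_self_nonneg (u : C(ℝ, ℝ)) : 0 ≤ unitIntervalForm u u :=
  intervalIntegral.integral_nonneg zero_le_one fun t _ ↦ mul_self_nonneg (u t)

lemma unitIntervalForm_congr {u u' v v' : C(ℝ, ℝ)} (hu : EqOn u u' (Icc 0 1))
    (hv : EqOn v v' (Icc 0 1)) : unitIntervalForm u v = unitIntervalForm u' v' := by
  refine intervalIntegral.integral_congr fun t ht ↦ ?_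
  rw [uIcc_of_le zero_le_one] at ht
  simp [hu ht, hv ht]

lemma eqOn_zero_of_unitIntervalForm_self {u : C(ℝ, ℝ)} (hu : unitIntervalForm u u = 0) :
    EqOn u 0 (Icc 0 1) := by
  intro x hx
  by_contra hne
  refine (intervalIntegral.integral_pos zero_lt_one (f := fun t ↦ u t * u t) (by fun_prop)
    (fun t _ ↦ mul_self_nonneg (u t)) ⟨x, hx, mul_self_pos.2 hne⟩).ne' hu

/-- A function whose `k`-th derivative vanishes is a polynomial of degree less than `k`. -/
lemma exists_polynomial_of_iteratedDerivWithin_eq_zero {k : ℕ} (hk : 1 ≤ k) {f : ℝ → ℝ}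
    (hf : ContDiffOn ℝ k f (Icc 0 1))
    (h0 : ∀ x ∈ Icc (0 : ℝ) 1, iteratedDerivWithin k f (Icc 0 1) x = 0) :
    ∃ c : ℕ → ℝ, ∀ x ∈ Icc (0 : ℝ) 1, f x = ∑ j ∈ Finset.range k, c j * x ^ j := by
  obtain ⟨n, rfl⟩ := Nat.exists_eq_add_of_le' hk
  refine ⟨fun j ↦ (j.factorial : ℝ)⁻¹ * iteratedDerivWithin j f (Icc 0 1) 0, fun x hx ↦ ?_⟩
  have := taylor_mean_remainder_bound (C := 0) zero_le_one (by exact_mod_cast hf) hx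
    (fun y hy ↦ by rw [h0 y hy, norm_zero])
  rw [zero_mul, zero_div, norm_le_zero_iff, sub_eq_zero, taylor_within_apply] at this
  rw [this]
  refine Finset.sum_congr rfl fun j _ ↦ ?_
  simp
  ring

section ContDiffOn

/-- The real functions that are `k` times continuously differentiable on `[0,1]`. -/
def contDiffOnSubmodule (k : ℕ) : Submodule ℝ (ℝ → ℝ) where
  carrier := {f | ContDiffOn ℝ k f (Icc 0 1)}
  add_mem' hf hg := ContDiffOn.add hf hg
  zero_mem' := contDiffOn_const
  smul_mem' _ _ hf := contDiffOn_const.smul hf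

variable {k : ℕ}

lemma contDiffOn_coe (f : contDiffOnSubmodule k) :
    ContDiffOn ℝ k (f : ℝ → ℝ) (Icc 0 1) := f.2

/-- The `k`-th derivative on `[0,1]`, extended to a continuous function on the line. -/
noncomputable def topDeriv (k : ℕ) : contDiffOnSubmodule k →ₗ[ℝ] C(ℝ, ℝ) where
  toFun f := ⟨IccExtend zero_le_one
      ((Icc (0 : ℝ) 1).domRestrict (iteratedDerivWithin k (f : ℝ → ℝ) (Icc 0 1))),
    ((contDiffOn_coe f).continuousOn_iteratedDerivWithin le_rfl
      (uniqueDiffOn_Icc zero_lt_one)).domRestrict.Icc_extend'⟩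
  map_add' f g := by
    ext x
    exact iteratedDerivWithin_add (Subtype.prop _) (uniqueDiffOn_Icc zero_lt_one)
      (contDiffOn_coe f _ (Subtype.prop _)) (contDiffOn_coe g _ (Subtype.prop _))
  map_smul' c f := by
    ext x
    exact iteratedDerivWithin_const_smul (Subtype.prop _) (uniqueDiffOn_Icc zero_lt_one) c
      (contDiffOn_coe f _ (Subtype.prop _))

lemma topDeriv_apply (f : contDiffOnSubmodule k) {x : ℝ} (hx : x ∈ Icc (0 : ℝ) 1) :
    topDeriv k f x = iteratedDerivWithin k (f : ℝ → ℝ) (Icc 0 1) x :=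
  IccExtend_of_mem zero_le_one
    ((Icc (0 : ℝ) 1).domRestrict (iteratedDerivWithin k (f : ℝ → ℝ) (Icc 0 1))) hx

lemma topDeriv_congr {f g : contDiffOnSubmodule k} (h : EqOn (f : ℝ → ℝ) g (Icc 0 1)) :
    EqOn (topDeriv k f) (topDeriv k g) (Icc 0 1) := fun x hx ↦ by
  rw [topDeriv_apply f hx, topDeriv_apply g hx, iteratedDerivWithin_congr h hx]

/-- `k`-fold integration from `0`, as a right inverse of `topDeriv`. -/
noncomputable def iteratedPrimitive (k : ℕ) : C(ℝ, ℝ) →ₗ[ℝ] contDiffOnSubmodule k where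
  toFun u := ⟨(primitive ^ k) u, (contDiff_primitive_pow k u).contDiffOn⟩
  map_add' u v := by ext x; simp
  map_smul' c u := by ext x; simp

lemma coe_iteratedPrimitive (u : C(ℝ, ℝ)) :
    (iteratedPrimitive k u : ℝ → ℝ) = (primitive ^ k) u := rfl

lemma topDeriv_iteratedPrimitive (u : C(ℝ, ℝ)) :
    EqOn (topDeriv k (iteratedPrimitive k u)) u (Icc 0 1) := fun x hx ↦ by
  rw [topDeriv_apply _ hx, coe_iteratedPrimitive, iteratedDerivWithin_eq_iteratedDeriv
    (uniqueDiffOn_Icc zero_lt_one) (contDiff_primitive_pow k u).contDiffAt hx,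
    iteratedDeriv_primitive_pow]

/-- The monomial `x ^ j` as an element of `contDiffOnSubmodule k`. -/
def monomialFun (k j : ℕ) : contDiffOnSubmodule k :=
  ⟨fun x ↦ x ^ j, (contDiff_id.pow j).contDiffOn⟩

lemma topDeriv_monomialFun {j : ℕ} (hj : j < k) :
    EqOn (topDeriv k (monomialFun k j)) 0 (Icc 0 1) := fun x hx ↦ by
  rw [topDeriv_apply _ hx]
  change iteratedDerivWithin k (fun x ↦ x ^ j) (Icc 0 1) x = 0
  rw [iteratedDerivWithin_eq_iteratedDeriv (uniqueDiffOn_Icc zero_lt_one)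
    (by fun_prop) hx]
  simp [Nat.descFactorial_eq_zero_iff_lt.2 hj]

/-- The polynomial functions of degree less than `k`. -/
def polySubmodule (k : ℕ) : Submodule ℝ (contDiffOnSubmodule k) :=
  Submodule.span ℝ (Set.image (monomialFun k) (Finset.range k))

instance : FiniteDimensional ℝ (polySubmodule k) :=
  FiniteDimensional.span_of_finite ℝ ((Finset.finite_toSet _).image _)

lemma monomialFun_mem_polySubmodule {j : ℕ} (hj : j < k) : monomialFun k j ∈ polySubmodule k :=
  Submodule.subset_span ⟨j, by simpa using hj, rfl⟩

lemma topDeriv_eqOn_zero_of_mem_polySubmodule {p : contDiffOnSubmodule k}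
    (hp : p ∈ polySubmodule k) : EqOn (topDeriv k p) 0 (Icc 0 1) := by
  induction hp using Submodule.span_induction with
  | mem p hp =>
    obtain ⟨j, hj, rfl⟩ := hp
    exact topDeriv_monomialFun (by simpa using hj)
  | zero => intro x _; simp
  | add p q _ _ hp hq => intro x hx; simp [hp hx, hq hx]
  | smul c p _ hp => intro x hx; simp [hp hx]

lemma coe_sum_smul_monomialFun (s : Finset ℕ) (c : ℕ → ℝ) (x : ℝ) :
    ((∑ j ∈ s, c j • monomialFun k j : contDiffOnSubmodule k) : ℝ → ℝ) x
      = ∑ j ∈ s, c j * x ^ j := by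
  simp [monomialFun]

/-- Taylor's formula: a `C^k` function is on `[0,1]` a polynomial of degree less than `k` plus the
`k`-fold primitive of its `k`-th derivative. -/
lemma exists_polynomial_add_iteratedPrimitive (hk : 1 ≤ k) (f : contDiffOnSubmodule k) :
    ∃ c : ℕ → ℝ, ∀ x ∈ Icc (0 : ℝ) 1, (f : ℝ → ℝ) x =
      ∑ j ∈ Finset.range k, c j * x ^ j + (primitive ^ k) (topDeriv k f) x := by
  obtain ⟨c, hc⟩ := exists_polynomial_of_iteratedDerivWithin_eq_zero hk
    (contDiffOn_coe (f - iteratedPrimitive k (topDeriv k f))) fun x hx ↦ by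
      rw [← topDeriv_apply _ hx, map_sub, ContinuousMap.sub_apply,
        topDeriv_iteratedPrimitive _ hx, sub_self]
  refine ⟨c, fun x hx ↦ ?_⟩
  rw [← hc x hx]
  simp [coe_iteratedPrimitive]

end ContDiffOn

section Averages

variable {k M i : ℕ}

lemma node_mem_Icc (hM : 0 < M) (hi : i ∈ Finset.Icc 1 M) :
    ((i : ℝ) - 1) / M ∈ Icc (0 : ℝ) 1 ∧ (i : ℝ) / M ∈ Icc (0 : ℝ) 1 := by
  have hM' : (0 : ℝ) < M := by exact_mod_cast hM
  obtain ⟨h₁, h₂⟩ := Finset.mem_Icc.1 hi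
  have h₁' : (1 : ℝ) ≤ i := by exact_mod_cast h₁
  have h₂' : (i : ℝ) ≤ M := by exact_mod_cast h₂
  refine ⟨⟨div_nonneg (by linarith) hM'.le, ?_⟩, div_nonneg (by linarith) hM'.le, ?_⟩ <;>
    rw [div_le_one hM'] <;> linarith

lemma node_sub_one_lt (hM : 0 < M) (i : ℕ) : ((i : ℝ) - 1) / M < (i : ℝ) / M := by
  have hM' : (0 : ℝ) < M := by exact_mod_cast hM
  gcongr
  linarith

lemma uIcc_node_subset (hM : 0 < M) (hi : i ∈ Finset.Icc 1 M) :
    uIcc (((i : ℝ) - 1) / M) ((i : ℝ) / M) ⊆ Icc (0 : ℝ) 1 :=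
  uIcc_subset_Icc (node_mem_Icc hM hi).1 (node_mem_Icc hM hi).2

lemma intervalAvg_congr (hM : 0 < M) (hi : i ∈ Finset.Icc 1 M) {f g : ℝ → ℝ}
    (h : EqOn f g (Icc 0 1)) : intervalAvg M f i = intervalAvg M g i := by
  unfold intervalAvg
  rw [intervalIntegral.integral_congr fun x hx ↦ h (uIcc_node_subset hM hi hx)]

lemma exists_linearMap_intervalAvg (k : ℕ) (hM : 0 < M) (hi : i ∈ Finset.Icc 1 M) :
    ∃ A : contDiffOnSubmodule k →ₗ[ℝ] ℝ, ∀ f, A f = intervalAvg M f i := by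
  have hint (f : contDiffOnSubmodule k) :
      IntervalIntegrable (f : ℝ → ℝ) volume (((i : ℝ) - 1) / M) ((i : ℝ) / M) :=
    ((contDiffOn_coe f).continuousOn.mono (uIcc_node_subset hM hi)).intervalIntegrable
  refine ⟨{ toFun := fun f ↦ intervalAvg M f i
            map_add' := fun f g ↦ ?_
            map_smul' := fun c f ↦ ?_ }, fun f ↦ rfl⟩
  · simp only [intervalAvg, ← mul_add]
    rw [← intervalIntegral.integral_add (hint f) (hint g)]
    rfl
  · simp only [intervalAvg, RingHom.id_apply, smul_eq_mul]
    rw [mul_left_comm, ← intervalIntegral.integral_const_mul c]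
    rfl

/-- The averages of a `k`-fold primitive have continuous kernels. -/
lemma exists_kernel_intervalAvg (hk : 1 ≤ k) (hM : 0 < M) (hi : i ∈ Finset.Icc 1 M) :
    ∃ K : C(ℝ, ℝ), ∀ u, intervalAvg M ((primitive ^ k) u) i = unitIntervalForm K u := by
  obtain ⟨m, rfl⟩ := Nat.exists_eq_add_of_le' hk
  obtain ⟨h₀, h₁⟩ := node_mem_Icc hM hi
  obtain ⟨K₀, hK₀⟩ := exists_kernel_primitive_pow m h₀
  obtain ⟨K₁, hK₁⟩ := exists_kernel_primitive_pow m h₁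
  refine ⟨(M : ℝ) • (K₁ - K₀), fun u ↦ ?_⟩
  rw [map_smul, map_sub, LinearMap.smul_apply, LinearMap.sub_apply, unitIntervalForm_apply,
    unitIntervalForm_apply, ← hK₀, ← hK₁, pow_succ' _ (m + 1), Module.End.mul_apply,
    primitive_apply, primitive_apply, intervalIntegral.integral_interval_sub_left
      (ContinuousMap.continuous _ |>.intervalIntegrable _ _)
      (ContinuousMap.continuous _ |>.intervalIntegrable _ _)]
  rfl

/-- A continuous function with zero average over an interval vanishes inside it. -/
lemma exists_mem_Ioo_eq_zero_of_intervalAvg_eq_zero (hM : 0 < M) (f : C(ℝ, ℝ))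
    (h : intervalAvg M f i = 0) :
    ∃ c ∈ Ioo (((i : ℝ) - 1) / M) ((i : ℝ) / M), f c = 0 := by
  refine exists_hasDerivAt_eq_zero (f := primitive f) (node_sub_one_lt hM i)
    (primitive f).continuous.continuousOn ?_ fun x _ ↦ hasDerivAt_primitive f x
  have hM' : (M : ℝ) ≠ 0 := by exact_mod_cast hM.ne'
  rw [eq_comm, ← sub_eq_zero, primitive_apply, primitive_apply,
    intervalIntegral.integral_interval_sub_left (f.continuous.intervalIntegrable _ _)
      (f.continuous.intervalIntegrable _ _)]
  exact (mul_eq_zero.1 h).resolve_left hM'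

open Polynomial in
/-- A polynomial of degree less than `M` all of whose averages vanish is zero. -/
lemma sum_mul_pow_eq_zero_of_intervalAvg_eq_zero (hM : k ≤ M) (hk : 0 < k) (c : ℕ → ℝ)
    (h : ∀ i ∈ Finset.Icc 1 M, intervalAvg M (fun x ↦ ∑ j ∈ Finset.range k, c j * x ^ j) i = 0)
    (x : ℝ) : ∑ j ∈ Finset.range k, c j * x ^ j = 0 := by
  have hM0 : 0 < M := hk.trans_le hM
  have hM' : (0 : ℝ) < M := by exact_mod_cast hM0
  let p : ℝ[X] := ∑ j ∈ Finset.range k, C (c j) * X ^ j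
  have hp (x : ℝ) : p.eval x = ∑ j ∈ Finset.range k, c j * x ^ j := by
    simp [p, eval_finsetSum]
  have hroot : ∀ i : Fin M, ∃ r ∈ Ioo ((i : ℝ) / M) (((i : ℝ) + 1) / M), p.eval r = 0 := by
    intro i
    obtain ⟨r, hr, hr0⟩ := exists_mem_Ioo_eq_zero_of_intervalAvg_eq_zero (i := i + 1) hM0
      ⟨fun x ↦ ∑ j ∈ Finset.range k, c j * x ^ j, by fun_prop⟩
      (h (i + 1) (Finset.mem_Icc.2 ⟨by lia, i.2⟩))
    refine ⟨r, by simpa using hr, by rw [hp]; exact hr0⟩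
  choose r hr hr0 using hroot
  have hinj : StrictMono r := fun i j hij ↦ by
    have hij' : ((i : ℕ) : ℝ) + 1 ≤ (j : ℕ) := by exact_mod_cast hij
    calc r i < ((i : ℝ) + 1) / M := (hr i).2
      _ ≤ (j : ℝ) / M := by gcongr
      _ < r j := (hr j).1
  have hdeg : p.natDegree < Fintype.card (Fin M) := by
    rw [Fintype.card_fin]
    refine lt_of_le_of_lt (natDegree_sum_le_of_forall_le (n := k - 1) _ _ fun j hj ↦ ?_) (by lia)
    exact (natDegree_C_mul_X_pow_le _ _).trans (by have := Finset.mem_range.1 hj; lia)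
  rw [← hp, eq_zero_of_natDegree_lt_card_of_eval_eq_zero p hinj.injective hr0 hdeg, eval_zero]

/-- A `C^k` function with vanishing `k`-th derivative and vanishing averages is zero. -/
lemma eqOn_zero_of_topDeriv_of_intervalAvg (hk : 0 < k) (hM : k ≤ M) (f : contDiffOnSubmodule k)
    (hD : EqOn (topDeriv k f) 0 (Icc 0 1)) (h : ∀ i ∈ Finset.Icc 1 M, intervalAvg M f i = 0) :
    EqOn (f : ℝ → ℝ) 0 (Icc 0 1) := by
  obtain ⟨c, hc⟩ := exists_polynomial_of_iteratedDerivWithin_eq_zero hk (contDiffOn_coe f)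
    fun x hx ↦ (topDeriv_apply f hx).symm.trans (hD hx)
  intro x hx
  rw [hc x hx]
  exact sum_mul_pow_eq_zero_of_intervalAvg_eq_zero hM hk c
    (fun i hi ↦ (intervalAvg_congr (hk.trans_le hM) hi hc).symm.trans (h i hi)) x

end Averages

/-- The `C^k` functions vanishing at the end points of `[0,1]`. -/
def vanishingSubmodule (k : ℕ) : Submodule ℝ (contDiffOnSubmodule k) where
  carrier := {f | (f : ℝ → ℝ) 0 = 0 ∧ (f : ℝ → ℝ) 1 = 0}
  add_mem' hf hg := by simp [hf.1, hf.2, hg.1, hg.2]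
  zero_mem' := by simp
  smul_mem' c f hf := by simp [hf.1, hf.2]

/-- There is a finite-dimensional space containing the polynomials of degree less than `k` such
that every function vanishing at the end points differs from an element of this space by a function
whose averages vanish and whose `k`-th derivative is orthogonal to those of the space. -/
lemma exists_finiteDimensional_orthogonal {k M : ℕ} (hk : 2 ≤ k) (hM : 0 < M) :
    ∃ W : Submodule ℝ (contDiffOnSubmodule k), FiniteDimensional ℝ W ∧ polySubmodule k ≤ W ∧
      ∀ h ∈ vanishingSubmodule k, ∃ w ∈ W ⊓ vanishingSubmodule k,
        (∀ i ∈ Finset.Icc 1 M,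
          intervalAvg M ((h - w : contDiffOnSubmodule k) : ℝ → ℝ) i = 0) ∧
        ∀ v ∈ W, unitIntervalForm (topDeriv k v) (topDeriv k (h - w)) = 0 := by
  obtain ⟨m, rfl⟩ := Nat.exists_eq_add_of_le' hk
  have hker : ∀ i, ∃ K : C(ℝ, ℝ), i ∈ Finset.Icc 1 M →
      ∀ u, intervalAvg M ((primitive ^ (m + 2)) u) i = unitIntervalForm K u := fun i ↦ by
    by_cases hi : i ∈ Finset.Icc 1 M
    · obtain ⟨K, hK⟩ := exists_kernel_intervalAvg (k := m + 2) (by lia) hM hi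
      exact ⟨K, fun _ ↦ hK⟩
    · exact ⟨0, fun h ↦ (hi h).elim⟩
  choose K hK using hker
  obtain ⟨K₁, hK₁⟩ := exists_kernel_primitive_pow m (right_mem_Icc.2 zero_le_one)
  let S : Submodule ℝ C(ℝ, ℝ) := Submodule.span ℝ (insert K₁ (Set.image K (Finset.Icc 1 M)))
  have : FiniteDimensional ℝ S :=
    FiniteDimensional.span_of_finite ℝ (((Finset.finite_toSet _).image _).insert _)
  refine ⟨polySubmodule (m + 2) ⊔ S.map (iteratedPrimitive (m + 2)), inferInstance, le_sup_left,
    fun h hh ↦ ?_⟩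
  obtain ⟨c, hc⟩ := exists_polynomial_add_iteratedPrimitive (by lia) h
  obtain ⟨s, hs, hsu⟩ := exists_mem_forall_mem_apply_sub_eq_zero unitIntervalForm
    unitIntervalForm_comm unitIntervalForm_self_nonneg S (topDeriv (m + 2) h)
  let w : contDiffOnSubmodule (m + 2) :=
    ∑ j ∈ Finset.range (m + 2), c j • monomialFun (m + 2) j + iteratedPrimitive (m + 2) s
  have hdiff : EqOn ((h - w : contDiffOnSubmodule (m + 2)) : ℝ → ℝ)
      (iteratedPrimitive (m + 2) (topDeriv (m + 2) h - s)) (Icc 0 1) := fun x hx ↦ by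
    have hw : (w : ℝ → ℝ) x
        = ∑ j ∈ Finset.range (m + 2), c j * x ^ j + (primitive ^ (m + 2)) s x := by
      rw [← coe_sum_smul_monomialFun (k := m + 2)]; rfl
    rw [coe_iteratedPrimitive, map_sub, ContinuousMap.sub_apply, Submodule.coe_sub, Pi.sub_apply,
      hc x hx, hw]
    ring
  have hvan : h - w ∈ vanishingSubmodule (m + 2) := by
    refine ⟨?_, ?_⟩
    · rw [hdiff (left_mem_Icc.2 zero_le_one)]
      exact primitive_pow_succ_apply_zero (m + 1) _
    · rw [hdiff (right_mem_Icc.2 zero_le_one)]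
      exact (hK₁ _).trans (hsu K₁ (Submodule.subset_span (mem_insert _ _)))
  refine ⟨w, ⟨Submodule.add_mem_sup (Submodule.sum_mem _ fun j hj ↦ Submodule.smul_mem _ _
    (monomialFun_mem_polySubmodule (Finset.mem_range.1 hj))) (Submodule.mem_map_of_mem hs), ?_⟩,
    fun i hi ↦ ?_, fun v hv ↦ ?_⟩
  · simpa using Submodule.sub_mem _ hh hvan
  · rw [intervalAvg_congr hM hi hdiff]
    exact (hK i hi _).trans (hsu (K i) (Submodule.subset_span
      (mem_insert_of_mem _ (mem_image_of_mem _ hi))))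
  · obtain ⟨p, hp, _, ⟨q, hq, rfl⟩, rfl⟩ := Submodule.mem_sup.1 hv
    have hv' : EqOn (topDeriv (m + 2) (p + iteratedPrimitive (m + 2) q)) q (Icc 0 1) :=
      fun x hx ↦ by
        rw [map_add, ContinuousMap.add_apply, topDeriv_eqOn_zero_of_mem_polySubmodule hp hx,
          topDeriv_iteratedPrimitive q hx, Pi.zero_apply, zero_add]
    rw [unitIntervalForm_congr hv' ((topDeriv_congr hdiff).trans (topDeriv_iteratedPrimitive _))]
    exact hsu q hq

lemma tikhonov_eq {k : ℕ} (M : ℕ) (α : ℝ) (Y : ℕ → ℝ) (f : contDiffOnSubmodule k) :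
    tikhonov M k α Y f = (1 / M) * ∑ i ∈ Finset.Icc 1 M, (Y i - intervalAvg M f i) ^ 2
      + α * unitIntervalForm (topDeriv k f) (topDeriv k f) := by
  unfold tikhonov
  congr 2
  refine intervalIntegral.integral_congr fun x hx ↦ ?_
  rw [uIcc_of_le zero_le_one] at hx
  simp only [topDeriv_apply f hx, sq]

/-- The Tikhonov functional is quadratic: its expansion in terms of a bilinear form and a linear
functional. -/
lemma exists_tikhonov_bilinForm (k : ℕ) {M : ℕ} (hM : 0 < M) (α : ℝ) (Y : ℕ → ℝ) :
    ∃ (B : contDiffOnSubmodule k →ₗ[ℝ] contDiffOnSubmodule k →ₗ[ℝ] ℝ)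
      (l : contDiffOnSubmodule k →ₗ[ℝ] ℝ),
      (∀ f g, B f g = (1 / M) * ∑ i ∈ Finset.Icc 1 M, intervalAvg M f i * intervalAvg M g i
        + α * unitIntervalForm (topDeriv k f) (topDeriv k g)) ∧
      (∀ f, l f = (1 / M) * ∑ i ∈ Finset.Icc 1 M, Y i * intervalAvg M f i) ∧
      ∀ f h : contDiffOnSubmodule k, tikhonov M k α Y (f + h : contDiffOnSubmodule k)
        = tikhonov M k α Y f + 2 * (B f h - l h) + B h h := by
  have hA : ∀ i, ∃ A : contDiffOnSubmodule k →ₗ[ℝ] ℝ,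
      i ∈ Finset.Icc 1 M → ∀ f, A f = intervalAvg M f i := fun i ↦ by
    by_cases hi : i ∈ Finset.Icc 1 M
    · obtain ⟨A, hA⟩ := exists_linearMap_intervalAvg k hM hi
      exact ⟨A, fun _ ↦ hA⟩
    · exact ⟨0, fun h ↦ (hi h).elim⟩
  choose A hA using hA
  let B : contDiffOnSubmodule k →ₗ[ℝ] contDiffOnSubmodule k →ₗ[ℝ] ℝ :=
    (1 / M : ℝ) • ∑ i ∈ Finset.Icc 1 M, (A i).smulRight (A i)
      + α • unitIntervalForm.compl₁₂ (topDeriv k) (topDeriv k)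
  have hB (f g) : B f g = (1 / M) * ∑ i ∈ Finset.Icc 1 M, intervalAvg M f i * intervalAvg M g i
      + α * unitIntervalForm (topDeriv k f) (topDeriv k g) := by
    simp only [B, LinearMap.add_apply, LinearMap.smul_apply, LinearMap.sum_apply,
      LinearMap.smulRight_apply, smul_eq_mul, LinearMap.compl₁₂_apply]
    congr 2
    exact Finset.sum_congr rfl fun i hi ↦ by rw [hA i hi, hA i hi]
  let l : contDiffOnSubmodule k →ₗ[ℝ] ℝ := (1 / M : ℝ) • ∑ i ∈ Finset.Icc 1 M, Y i • A i
  have hl (f) : l f = (1 / M) * ∑ i ∈ Finset.Icc 1 M, Y i * intervalAvg M f i := by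
    simp only [l, LinearMap.smul_apply, LinearMap.sum_apply, smul_eq_mul]
    congr 1
    exact Finset.sum_congr rfl fun i hi ↦ by rw [hA i hi]
  refine ⟨B, l, hB, hl, fun f h ↦ ?_⟩
  have hsum : ∑ i ∈ Finset.Icc 1 M,
        (Y i - intervalAvg M ((f + h : contDiffOnSubmodule k) : ℝ → ℝ) i) ^ 2
      = ∑ i ∈ Finset.Icc 1 M, (Y i - intervalAvg M f i) ^ 2
        + 2 * (∑ i ∈ Finset.Icc 1 M, intervalAvg M f i * intervalAvg M h i
          - ∑ i ∈ Finset.Icc 1 M, Y i * intervalAvg M h i)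
        + ∑ i ∈ Finset.Icc 1 M, intervalAvg M h i * intervalAvg M h i := by
    rw [← Finset.sum_sub_distrib, Finset.mul_sum, ← Finset.sum_add_distrib,
      ← Finset.sum_add_distrib]
    refine Finset.sum_congr rfl fun i hi ↦ ?_
    rw [← hA i hi, ← hA i hi, ← hA i hi, map_add]
    ring
  rw [tikhonov_eq, tikhonov_eq, hsum, hB, hB, hl]
  simp only [map_add, LinearMap.add_apply]
  rw [unitIntervalForm_comm (topDeriv k h) (topDeriv k f)]
  ring

/-- Existence and uniqueness of the minimizer of the Tikhonov functional `Φ` among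
functions `f` that are `k` times continuously differentiable on `[0,1]` with
`f(0) = y₀`, `f(1) = y₁`. Uniqueness is as functions on `[0,1]`. -/
theorem exists_unique_minimizer (k M : ℕ) (hk : 2 ≤ k) (hM : k < M)
    (α : ℝ) (hα : 0 < α) (Ytil : ℕ → ℝ) (y₀ y₁ : ℝ) :
    ∃ fstar : ℝ → ℝ,
      (ContDiffOn ℝ k fstar (Icc 0 1) ∧ fstar 0 = y₀ ∧ fstar 1 = y₁) ∧
      (∀ f : ℝ → ℝ, ContDiffOn ℝ k f (Icc 0 1) → f 0 = y₀ → f 1 = y₁ →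
        tikhonov M k α Ytil fstar ≤ tikhonov M k α Ytil f) ∧
      (∀ g : ℝ → ℝ, ContDiffOn ℝ k g (Icc 0 1) → g 0 = y₀ → g 1 = y₁ →
        (∀ f : ℝ → ℝ, ContDiffOn ℝ k f (Icc 0 1) → f 0 = y₀ → f 1 = y₁ →
          tikhonov M k α Ytil g ≤ tikhonov M k α Ytil f) →
        EqOn g fstar (Icc 0 1)) := by
  have hM0 : 0 < M := by lia
  have hMR : (0 : ℝ) < 1 / M := by positivity
  obtain ⟨B, l, hB, hl, hexp⟩ := exists_tikhonov_bilinForm k hM0 α Ytil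
  have hsq (f : contDiffOnSubmodule k) :
      0 ≤ ∑ i ∈ Finset.Icc 1 M, intervalAvg M f i * intervalAvg M f i :=
    Finset.sum_nonneg fun i _ ↦ mul_self_nonneg _
  have hpos (f) : 0 ≤ B f f := by
    rw [hB]
    exact add_nonneg (mul_nonneg hMR.le (hsq f))
      (mul_nonneg hα.le (unitIntervalForm_self_nonneg _))
  have hnull (f) (hf : B f f = 0) :
      (∀ i ∈ Finset.Icc 1 M, intervalAvg M f i = 0) ∧ EqOn (topDeriv k f) 0 (Icc 0 1) := by
    rw [hB, add_eq_zero_iff_of_nonneg (mul_nonneg hMR.le (hsq f))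
      (mul_nonneg hα.le (unitIntervalForm_self_nonneg _))] at hf
    refine ⟨fun i hi ↦ ?_, eqOn_zero_of_unitIntervalForm_self
      ((mul_eq_zero.1 hf.2).resolve_left hα.ne')⟩
    exact mul_self_eq_zero.1 ((Finset.sum_eq_zero_iff_of_nonneg
      fun i _ ↦ mul_self_nonneg _).1 ((mul_eq_zero.1 hf.1).resolve_left hMR.ne') i hi)
  obtain ⟨W, _, hpW, hW⟩ := exists_finiteDimensional_orthogonal hk hM0
  let f₀ : contDiffOnSubmodule k := y₀ • monomialFun k 0 + (y₁ - y₀) • monomialFun k 1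
  have hf₀W : f₀ ∈ W := hpW (add_mem
    (Submodule.smul_mem _ _ (monomialFun_mem_polySubmodule (by lia)))
    (Submodule.smul_mem _ _ (monomialFun_mem_polySubmodule (by lia))))
  obtain ⟨v, hv, hvB⟩ := exists_mem_forall_mem_apply_eq B (W ⊓ vanishingSubmodule k) (l - B f₀)
    fun x _ hx ↦ by
      obtain ⟨hx₁, hx₂⟩ := hnull x hx
      have hx₃ : unitIntervalForm (topDeriv k f₀) (topDeriv k x) = 0 := by
        rw [unitIntervalForm_congr (v' := 0) (fun _ _ ↦ rfl) hx₂, map_zero]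
      rw [LinearMap.sub_apply, hl, hB, hx₃,
        Finset.sum_eq_zero fun i hi ↦ by rw [hx₁ i hi, mul_zero],
        Finset.sum_eq_zero fun i hi ↦ by rw [hx₁ i hi, mul_zero]]
      simp
  have hstat : ∀ h ∈ vanishingSubmodule k, B (f₀ + v) h = l h := by
    intro h hh
    obtain ⟨w, hw, hwA, hwD⟩ := hW h hh
    have h₁ : B (f₀ + v) (h - w) = 0 := by
      rw [hB, hwD _ (add_mem hf₀W hv.1), Finset.sum_eq_zero fun i hi ↦ by rw [hwA i hi, mul_zero]]
      simp
    have h₂ : l (h - w) = 0 := by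
      rw [hl, Finset.sum_eq_zero fun i hi ↦ by rw [hwA i hi, mul_zero], mul_zero]
    have h₃ : B (f₀ + v) w = l w := by
      rw [map_add, LinearMap.add_apply, hvB w hw, LinearMap.sub_apply, add_sub_cancel]
    rw [← sub_add_cancel h w, map_add (B (f₀ + v)), map_add l, h₁, h₂, h₃]
  have hval₀ : ((f₀ + v : contDiffOnSubmodule k) : ℝ → ℝ) 0 = y₀ := by
    simp [f₀, monomialFun, hv.2.1]
  have hval₁ : ((f₀ + v : contDiffOnSubmodule k) : ℝ → ℝ) 1 = y₁ := by
    simp [f₀, monomialFun, hv.2.2]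
  have hcomp (f : contDiffOnSubmodule k) (h0 : (f : ℝ → ℝ) 0 = y₀) (h1 : (f : ℝ → ℝ) 1 = y₁) :
      tikhonov M k α Ytil f = tikhonov M k α Ytil (f₀ + v : contDiffOnSubmodule k)
        + B (f - (f₀ + v)) (f - (f₀ + v)) := by
    have hmem : f - (f₀ + v) ∈ vanishingSubmodule k :=
      ⟨by rw [Submodule.coe_sub, Pi.sub_apply, h0, hval₀, sub_self],
        by rw [Submodule.coe_sub, Pi.sub_apply, h1, hval₁, sub_self]⟩
    have := hexp (f₀ + v) (f - (f₀ + v))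
    rwa [add_sub_cancel, hstat _ hmem, sub_self, mul_zero, add_zero] at this
  refine ⟨(f₀ + v : contDiffOnSubmodule k), ⟨contDiffOn_coe _, hval₀, hval₁⟩,
    fun f hf h0 h1 ↦ ?_, fun g hg h0 h1 hmin ↦ ?_⟩
  · have := hcomp ⟨f, hf⟩ h0 h1
    have := hpos (⟨f, hf⟩ - (f₀ + v))
    linarith
  · have h₁ := hcomp ⟨g, hg⟩ h0 h1
    have h₂ := hpos (⟨g, hg⟩ - (f₀ + v))
    have h₃ := hmin _ (contDiffOn_coe (f₀ + v)) hval₀ hval₁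
    obtain ⟨hA, hD⟩ := hnull (⟨g, hg⟩ - (f₀ + v)) (by linarith)
    intro x hx
    exact sub_eq_zero.1 (eqOn_zero_of_topDeriv_of_intervalAvg (by lia) hM.le _ hD hA hx)
end

section
/- Let g : [0,1] → ℝ be continuously differentiable. Then ‖g − Q_{h_M} g‖_{L²(0,1)} ≤ h_M·‖g'‖_{L²(0,1)}, i.e. ∫_0^1 (g(x) − Q_{h_M}g(x))² dx ≤ h_M²·∫_0^1 (g'(x))² dx. -/
open MeasureTheory Set

/-- The piecewise-average interpolation operator `Q_{h_M}`: on each subinterval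
`(x_{i−1}, x_i)` of the uniform partition of `[0,1]` into `M` pieces, `Q_{h_M} g`
takes the constant value `M_i(g)`, the average of `g` over that subinterval. -/
noncomputable def stepAvg (M : ℕ) (g : ℝ → ℝ) (x : ℝ) : ℝ :=
  (M : ℝ) * ∫ t in ((⌊(M : ℝ) * x⌋ : ℝ) / M)..(((⌊(M : ℝ) * x⌋ : ℝ) + 1) / M), g t

/-- Cauchy–Schwarz inequality for the integral of a continuous function against `1`. -/
lemma sq_intervalIntegral_le {a b : ℝ} {f : ℝ → ℝ} (hab : a ≤ b) (hf : ContinuousOn f (Icc a b)) :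
    (∫ x in a..b, f x) ^ 2 ≤ (b - a) * ∫ x in a..b, f x ^ 2 := by
  rcases hab.eq_or_lt with rfl | hlt
  · simp
  have hfi : IntervalIntegrable f volume a b := hf.intervalIntegrable_of_Icc hab
  have hf2 : IntervalIntegrable (fun x => f x ^ 2) volume a b :=
    (hf.pow 2).intervalIntegrable_of_Icc hab
  set I := ∫ x in a..b, f x
  have hexp : ∫ x in a..b, ((b - a) * f x - I) ^ 2
      = (b - a) * ((b - a) * (∫ x in a..b, f x ^ 2) - I ^ 2) := by
    have hrw : ∀ x, ((b - a) * f x - I) ^ 2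
        = (b - a) ^ 2 * f x ^ 2 - 2 * (b - a) * I * f x + I ^ 2 := fun x => by ring
    simp_rw [hrw]
    rw [intervalIntegral.integral_add ((hf2.const_mul _).sub (hfi.const_mul _))
        intervalIntegrable_const,
      intervalIntegral.integral_sub (hf2.const_mul _) (hfi.const_mul _),
      intervalIntegral.integral_const_mul, intervalIntegral.integral_const_mul,
      intervalIntegral.integral_const, smul_eq_mul]
    ring
  have hnonneg : 0 ≤ ∫ x in a..b, ((b - a) * f x - I) ^ 2 :=
    intervalIntegral.integral_nonneg hab fun x _ => sq_nonneg _
  rw [hexp] at hnonneg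
  linarith [nonneg_of_mul_nonneg_right hnonneg (sub_pos.2 hlt)]

/-- The squared oscillation of a `C¹` function on an interval is at most the length of the interval
times the integral of the squared derivative. -/
lemma sq_sub_le_mul_integral_sq_deriv {a b : ℝ} {g f : ℝ → ℝ} (hg : ContinuousOn g (Icc a b))
    (hf : ContinuousOn f (Icc a b)) (hderiv : ∀ x ∈ Ioo a b, HasDerivAt g (f x) x)
    {u v : ℝ} (hu : u ∈ Icc a b) (hv : v ∈ Icc a b) :
    (g v - g u) ^ 2 ≤ (b - a) * ∫ x in a..b, f x ^ 2 := by
  wlog huv : u ≤ v generalizing u v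
  · rw [← neg_sq, neg_sub]
    exact this hv hu (le_of_not_ge huv)
  have hsub : Icc u v ⊆ Icc a b := Icc_subset_Icc hu.1 hv.2
  rw [← intervalIntegral.integral_eq_sub_of_hasDerivAt_of_le huv (hg.mono hsub)
    (fun x hx => hderiv x (Ioo_subset_Ioo hu.1 hv.2 hx))
    ((hf.mono hsub).intervalIntegrable_of_Icc huv)]
  refine (sq_intervalIntegral_le huv (hf.mono hsub)).trans ?_
  refine mul_le_mul (by linarith [hu.1, hv.2]) ?_
    (intervalIntegral.integral_nonneg huv fun x _ => sq_nonneg _) (by linarith [hu.1, hv.2])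
  exact intervalIntegral.integral_mono_interval hu.1 huv hv.2
    (Filter.Eventually.of_forall fun x => sq_nonneg (f x))
    ((hf.pow 2).intervalIntegrable_of_Icc (hu.1.trans hu.2))

/-- Poincaré inequality on an interval for the deviation of a `C¹` function from its mean. -/
lemma integral_sq_sub_average_le {a b : ℝ} {g f : ℝ → ℝ} (hab : a < b)
    (hg : ContinuousOn g (Icc a b)) (hf : ContinuousOn f (Icc a b))
    (hderiv : ∀ x ∈ Ioo a b, HasDerivAt g (f x) x) :
    ∫ x in a..b, (g x - (b - a)⁻¹ * ∫ t in a..b, g t) ^ 2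
      ≤ (b - a) ^ 2 * ∫ x in a..b, f x ^ 2 := by
  obtain ⟨c, hc, hcm⟩ := exists_eq_interval_average (f := g) hab.ne
    (by rwa [uIcc_of_le hab.le])
  rw [uIoo_of_le hab.le] at hc
  rw [interval_average_eq, smul_eq_mul] at hcm
  rw [← hcm]
  calc ∫ x in a..b, (g x - g c) ^ 2
      ≤ ∫ _ in a..b, (b - a) * ∫ x in a..b, f x ^ 2 :=
        intervalIntegral.integral_mono_on hab.le
          (((hg.sub continuousOn_const).pow 2).intervalIntegrable_of_Icc hab.le)
          intervalIntegrable_const fun x hx =>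
            sq_sub_le_mul_integral_sq_deriv hg hf hderiv (Ioo_subset_Icc_self hc) hx
    _ = (b - a) ^ 2 * ∫ x in a..b, f x ^ 2 := by
        rw [intervalIntegral.integral_const, smul_eq_mul]
        ring

lemma stepAvg_eq_of_mem_Ico {M : ℕ} (hM : 0 < M) (g : ℝ → ℝ) {k : ℕ} {x : ℝ}
    (hx : x ∈ Ico ((k : ℝ) / M) (((k + 1 : ℕ) : ℝ) / M)) :
    stepAvg M g x = M * ∫ t in ((k : ℝ) / M)..(((k + 1 : ℕ) : ℝ) / M), g t := by
  have hM0 : (0 : ℝ) < M := Nat.cast_pos.2 hM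
  have hfloor : ⌊(M : ℝ) * x⌋ = (k : ℤ) := by
    rw [Int.floor_eq_iff]
    have h1 := (div_le_iff₀' hM0).1 hx.1
    have h2 := (lt_div_iff₀' hM0).1 hx.2
    push_cast at h2 ⊢
    exact ⟨h1, h2⟩
  simp [stepAvg, hfloor]

/-- For continuously differentiable `g` on `[0,1]`,
`‖g − Q_{h_M} g‖_{L²(0,1)} ≤ h_M ‖g'‖_{L²(0,1)}` (squared form). -/
theorem stepAvg_L2_error (M : ℕ) (hM : 2 ≤ M) (g : ℝ → ℝ)
    (hg : ContDiffOn ℝ 1 g (Icc 0 1)) :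
    ∫ x in (0:ℝ)..1, (g x - stepAvg M g x) ^ 2
      ≤ (1 / M : ℝ) ^ 2 * ∫ x in (0:ℝ)..1, (derivWithin g (Icc 0 1) x) ^ 2 := by
  have hMpos : 0 < M := by omega
  have hM0 : (0 : ℝ) < M := Nat.cast_pos.2 hMpos
  set f := derivWithin g (Icc 0 1)
  have hf : ContinuousOn f (Icc 0 1) :=
    hg.continuousOn_derivWithin (uniqueDiffOn_Icc zero_lt_one) le_rfl
  have hderiv : ∀ x ∈ Ioo (0 : ℝ) 1, HasDerivAt g (f x) x := fun x hx =>
    ((hg.differentiableOn one_ne_zero x (Ioo_subset_Icc_self hx)).hasDerivWithinAt).hasDerivAt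
      (Icc_mem_nhds hx.1 hx.2)
  set p : ℕ → ℝ := fun k => (k : ℝ) / M with hp
  have hp0 : p 0 = 0 := by simp [hp]
  have hpM : p M = 1 := div_self hM0.ne'
  have hlen : ∀ k, p (k + 1) - p k = 1 / M := fun k => by
    simp only [hp]; push_cast; ring
  have hlt : ∀ k, p k < p (k + 1) := fun k => by
    have := hlen k
    have := one_div_pos.2 hM0
    linarith
  have hlo : ∀ k, 0 ≤ p k := fun k => by positivity
  have hhi : ∀ k < M, p (k + 1) ≤ 1 := fun k hk =>
    (div_le_one hM0).2 (Nat.cast_le.2 hk)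
  have hsub : ∀ k < M, Icc (p k) (p (k + 1)) ⊆ Icc 0 1 := fun k hk =>
    Icc_subset_Icc (hlo k) (hhi k hk)
  have heq : ∀ k, EqOn (fun x => (g x - (p (k + 1) - p k)⁻¹ * ∫ t in p k..p (k + 1), g t) ^ 2)
      (fun x => (g x - stepAvg M g x) ^ 2) (Ioo (p k) (p (k + 1))) := fun k x hx => by
    have havg := stepAvg_eq_of_mem_Ico hMpos g (Ioo_subset_Ico_self hx)
    simp only [havg, hlen, one_div, inv_inv]
    rfl
  have hint : ∀ k < M, IntervalIntegrable (fun x => (g x - stepAvg M g x) ^ 2) volume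
      (p k) (p (k + 1)) := fun k hk =>
    ((((hg.continuousOn.mono (hsub k hk)).sub continuousOn_const).pow
      2).intervalIntegrable_of_Icc (hlt k).le).congr_uIoo
      (by rw [uIoo_of_le (hlt k).le]; exact heq k)
  have hfint : ∀ k < M, IntervalIntegrable (fun x => f x ^ 2) volume (p k) (p (k + 1)) :=
    fun k hk => ((hf.mono (hsub k hk)).pow 2).intervalIntegrable_of_Icc (hlt k).le
  have hsum := intervalIntegral.sum_integral_adjacent_intervals hint
  have hfsum := intervalIntegral.sum_integral_adjacent_intervals hfint
  rw [hp0, hpM] at hsum hfsum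
  rw [← hsum, ← hfsum, Finset.mul_sum]
  refine Finset.sum_le_sum fun k hk => ?_
  have hk := Finset.mem_range.1 hk
  rw [← intervalIntegral.integral_congr_Ioo_of_le (hlt k).le (heq k), ← hlen k]
  exact integral_sq_sub_average_le (hlt k) (hg.continuousOn.mono (hsub k hk))
    (hf.mono (hsub k hk)) fun x hx => hderiv x (Ioo_subset_Ioo (hlo k) (hhi k hk) hx)
end

section
/- Let k ≥ 2, M ≥ 2, N ≥ 1 be integers, α > 0, and Ỹ_1,…,Ỹ_M ∈ ℝ. Let y : [0,1] → ℝ be k times continuously differentiable with |y'(x)| ≤ Q for all x ∈ [0,1]. Let f_* : [0,1] → ℝ be k times continuously differentiable with f_*(0) = y(0), f_*(1) = y(1), and Φ(f_*) ≤ Φ(y) (for instance, f_* minimizes Φ among such functions). Set e = f_* − y. Then ‖e^{(k)}‖ ≤ sqrt(2·Δ_M²/α + 2·Q²·h_M²/(α·N²)) + 2·‖y^{(k)}‖. -/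
open MeasureTheory Set

/-- The exact group means `Y_i = (1/N) ∑_{j=(i−1)N+1}^{iN} y(ĵ/(MN))`. -/
noncomputable def groupMean (M N : ℕ) (y : ℝ → ℝ) (i : ℕ) : ℝ :=
  (1 / N) * ∑ j ∈ Finset.Icc ((i - 1) * N + 1) (i * N), y ((j : ℝ) / (M * N))

/-- The statistic `Δ_M² = (1/M) ∑_{i=1}^M (Ỹ_i − Y_i)²`. -/
noncomputable def deltaSq (M N : ℕ) (Ytil : ℕ → ℝ) (y : ℝ → ℝ) : ℝ :=
  (1 / M) * ∑ i ∈ Finset.Icc 1 M, (Ytil i - groupMean M N y i) ^ 2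

/-- The `L²(0,1)` norm. -/
noncomputable def l2norm (g : ℝ → ℝ) : ℝ :=
  Real.sqrt (∫ x in (0:ℝ)..1, g x ^ 2)

/-- Cauchy–Schwarz for continuous functions on `[0, 1]`. -/
theorem integral_mul_sq_le {u v : ℝ → ℝ} (hu : ContinuousOn u (Icc 0 1))
    (hv : ContinuousOn v (Icc 0 1)) :
    (∫ x in (0:ℝ)..1, u x * v x) ^ 2
      ≤ (∫ x in (0:ℝ)..1, u x ^ 2) * ∫ x in (0:ℝ)..1, v x ^ 2 := by
  have integrable : ∀ {g : ℝ → ℝ}, ContinuousOn g (Icc 0 1) →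
      IntervalIntegrable g volume 0 1 := fun h =>
    h.intervalIntegrable_of_Icc zero_le_one
  have key : ∀ t : ℝ, 0 ≤ (∫ x in (0:ℝ)..1, v x ^ 2) * (t * t)
      + (2 * ∫ x in (0:ℝ)..1, u x * v x) * t + ∫ x in (0:ℝ)..1, u x ^ 2 := by
    intro t
    have h : 0 ≤ ∫ x in (0:ℝ)..1, (u x + t * v x) ^ 2 :=
      intervalIntegral.integral_nonneg zero_le_one fun x _ => sq_nonneg _
    have e : (fun x => (u x + t * v x) ^ 2)
        = fun x => (t * t) * v x ^ 2 + (2 * t) * (u x * v x) + u x ^ 2 := by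
      funext x; ring
    rw [e, intervalIntegral.integral_add, intervalIntegral.integral_add,
      intervalIntegral.integral_const_mul, intervalIntegral.integral_const_mul] at h
    · linarith
    all_goals exact integrable (by fun_prop)
  have := discrim_le_zero key
  unfold discrim at this
  linarith

theorem l2norm_sq (g : ℝ → ℝ) : l2norm g ^ 2 = ∫ x in (0:ℝ)..1, g x ^ 2 :=
  Real.sq_sqrt (intervalIntegral.integral_nonneg zero_le_one fun _ _ => sq_nonneg _)

/-- The triangle inequality for the `L²` norm of continuous functions on `[0, 1]`. -/
theorem l2norm_sub_le {u v : ℝ → ℝ} (hu : ContinuousOn u (Icc 0 1))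
    (hv : ContinuousOn v (Icc 0 1)) :
    l2norm (fun x => u x - v x) ≤ l2norm u + l2norm v := by
  have integrable : ∀ {g : ℝ → ℝ}, ContinuousOn g (Icc 0 1) →
      IntervalIntegrable g volume 0 1 := fun h =>
    h.intervalIntegrable_of_Icc zero_le_one
  have hu0 : 0 ≤ l2norm u := Real.sqrt_nonneg _
  have hv0 : 0 ≤ l2norm v := Real.sqrt_nonneg _
  have hcs := integral_mul_sq_le hu hv
  rw [← l2norm_sq u, ← l2norm_sq v, ← mul_pow] at hcs
  have hlow := (abs_le_of_sq_le_sq' hcs (by positivity)).1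
  have e : (fun x => (u x - v x) ^ 2)
      = fun x => u x ^ 2 - 2 * (u x * v x) + v x ^ 2 := by
    funext x; ring
  refine Real.sqrt_le_iff.2 ⟨by positivity, ?_⟩
  rw [e, intervalIntegral.integral_add, intervalIntegral.integral_sub,
    intervalIntegral.integral_const_mul, ← l2norm_sq u, ← l2norm_sq v]
  · nlinarith
  all_goals exact integrable (by fun_prop)

/-- The error of the right-endpoint rule on an interval of length `b - a`. -/
theorem abs_mul_sub_integral_le {f : ℝ → ℝ} {Q a b : ℝ} (hab : a ≤ b)
    (hf : IntervalIntegrable f volume a b)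
    (hlip : ∀ x ∈ Icc a b, |f b - f x| ≤ Q * (b - x)) (hQ : 0 ≤ Q) :
    |(b - a) * f b - ∫ x in a..b, f x| ≤ Q * (b - a) * (b - a) := by
  have e : (b - a) * f b - ∫ x in a..b, f x = ∫ x in a..b, (f b - f x) := by
    rw [intervalIntegral.integral_sub intervalIntegrable_const hf]
    simp
  rw [e, ← Real.norm_eq_abs]
  refine (intervalIntegral.norm_integral_le_of_norm_le_const (C := Q * (b - a)) ?_).trans_eq ?_
  · intro x hx
    rw [uIoc_of_le hab] at hx
    refine (hlip x ⟨hx.1.le, hx.2⟩).trans ?_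
    gcongr
    exact hx.1.le
  · rw [abs_of_nonneg (sub_nonneg.2 hab)]

/-- Group means on the fine grid approximate the interval averages. -/
theorem abs_groupMean_sub_intervalAvg_le {M N : ℕ} (hM : 0 < M) (hN : 0 < N) {Q : ℝ}
    {y : ℝ → ℝ} (hy : ContinuousOn y (Icc 0 1)) (hQ : 0 ≤ Q)
    (hlip : ∀ a ∈ Icc (0:ℝ) 1, ∀ b ∈ Icc (0:ℝ) 1, |y b - y a| ≤ Q * |b - a|)
    {i : ℕ} (hi : i ∈ Finset.Icc 1 M) :
    |groupMean M N y i - intervalAvg M y i| ≤ Q / (M * N) := by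
  obtain ⟨hi1, hiM⟩ := Finset.mem_Icc.1 hi
  have hM' : (0:ℝ) < M := by exact_mod_cast hM
  have hN' : (0:ℝ) < N := by exact_mod_cast hN
  set c : ℕ → ℝ := fun j => (j : ℝ) / (M * N) with hc
  have hstep : ∀ j, c (j + 1) - c j = 1 / (M * N) := by
    intro j
    simp only [hc]
    push_cast
    ring
  have hmono : ∀ j, c j ≤ c (j + 1) := fun j => by
    have : (0:ℝ) < 1 / (M * N) := by positivity
    linarith [hstep j]
  have hsub : ∀ j ∈ Finset.Ico ((i - 1) * N) (i * N), Icc (c j) (c (j + 1)) ⊆ Icc 0 1 := by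
    intro j hj
    refine Icc_subset_Icc (by positivity) ?_
    have h : j + 1 ≤ M * N := (Nat.succ_le_of_lt (Finset.mem_Ico.1 hj).2).trans (Nat.mul_le_mul_right N hiM)
    simp only [hc]
    rw [div_le_one (by positivity)]
    exact_mod_cast h
  have hint : ∀ j ∈ Finset.Ico ((i - 1) * N) (i * N),
      IntervalIntegrable y volume (c j) (c (j + 1)) := fun j hj =>
    (hy.mono (hsub j hj)).intervalIntegrable_of_Icc (hmono j)
  have hle : (i - 1) * N ≤ i * N := Nat.mul_le_mul_right N (Nat.sub_le i 1)
  have havg : intervalAvg M y i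
      = M * ∑ j ∈ Finset.Ico ((i - 1) * N) (i * N), ∫ x in (c j)..(c (j + 1)), y x := by
    rw [intervalIntegral.sum_integral_adjacent_intervals_Ico hle
      (fun j hj => hint j (by simpa using hj))]
    unfold intervalAvg
    congr 2 <;> simp only [hc] <;> push_cast [Nat.cast_sub hi1] <;> field_simp
  have hgrp : groupMean M N y i
      = M * ∑ j ∈ Finset.Ico ((i - 1) * N) (i * N), (c (j + 1) - c j) * y (c (j + 1)) := by
    have e : Finset.Icc ((i - 1) * N + 1) (i * N)
        = Finset.Ico ((i - 1) * N + 1) (i * N + 1) := by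
      ext; simp
    simp only [hstep]
    unfold groupMean
    rw [e, ← Finset.sum_Ico_add' (fun j : ℕ => y ((j : ℝ) / (M * N))), ← Finset.mul_sum,
      ← mul_assoc]
    congr 1
    field_simp
  have hcard : (Finset.Ico ((i - 1) * N) (i * N)).card = N := by
    rw [Nat.card_Ico, ← Nat.sub_mul, Nat.sub_sub_self hi1, one_mul]
  rw [havg, hgrp, ← mul_sub, ← Finset.sum_sub_distrib, abs_mul, abs_of_pos hM']
  calc (M : ℝ) * |∑ j ∈ Finset.Ico ((i - 1) * N) (i * N),
        ((c (j + 1) - c j) * y (c (j + 1)) - ∫ x in (c j)..(c (j + 1)), y x)|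
      ≤ M * ∑ j ∈ Finset.Ico ((i - 1) * N) (i * N), Q * (1 / (M * N)) * (1 / (M * N)) := by
        gcongr
        refine (Finset.abs_sum_le_sum_abs _ _).trans (Finset.sum_le_sum fun j hj => ?_)
        rw [← hstep j]
        refine abs_mul_sub_integral_le (hmono j) (hint j hj) (fun x hx => ?_) hQ
        have h := hlip x (hsub j hj hx) _ (hsub j hj (right_mem_Icc.2 (hmono j)))
        rwa [abs_of_nonneg (sub_nonneg.2 hx.2)] at h
    _ = Q / (M * N) := by
        rw [Finset.sum_const, hcard, nsmul_eq_mul]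
        field_simp

/-- The data misfit of `y` is controlled by `Δ_M²` and the quadrature error. -/
theorem misfit_le {M N : ℕ} (hM : 0 < M) {Ytil : ℕ → ℝ} {y : ℝ → ℝ} {δ : ℝ}
    (h : ∀ i ∈ Finset.Icc 1 M, |groupMean M N y i - intervalAvg M y i| ≤ δ) :
    (1 / M : ℝ) * ∑ i ∈ Finset.Icc 1 M, (Ytil i - intervalAvg M y i) ^ 2
      ≤ 2 * deltaSq M N Ytil y + 2 * δ ^ 2 := by
  have hM' : (0:ℝ) < M := by exact_mod_cast hM
  calc (1 / M : ℝ) * ∑ i ∈ Finset.Icc 1 M, (Ytil i - intervalAvg M y i) ^ 2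
      ≤ (1 / M : ℝ) * ∑ i ∈ Finset.Icc 1 M,
          (2 * (Ytil i - groupMean M N y i) ^ 2 + 2 * δ ^ 2) := by
        gcongr with i hi
        have h1 : (groupMean M N y i - intervalAvg M y i) ^ 2 ≤ δ ^ 2 :=
          sq_le_sq.2 ((h i hi).trans (le_abs_self δ))
        nlinarith [sq_nonneg ((Ytil i - groupMean M N y i)
          - (groupMean M N y i - intervalAvg M y i))]
    _ = 2 * deltaSq M N Ytil y + 2 * δ ^ 2 := by
        rw [Finset.sum_add_distrib, ← Finset.mul_sum, Finset.sum_const, Nat.card_Icc,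
          nsmul_eq_mul, deltaSq]
        field_simp
        simp

/-- Estimate `‖e^{(k)}‖ ≤ sqrt(2Δ_M²/α + 2Q²h_M²/(αN²)) + 2‖y^{(k)}‖` for
`e = f_* − y`, where `f_*` satisfies `Φ(f_*) ≤ Φ(y)`. -/
theorem kth_derivative_error_bound (k M N : ℕ) (hk : 2 ≤ k) (hM : 2 ≤ M) (hN : 1 ≤ N)
    (α : ℝ) (hα : 0 < α) (Ytil : ℕ → ℝ) (Q : ℝ) (y fstar : ℝ → ℝ)
    (hy : ContDiffOn ℝ k y (Icc 0 1))
    (hQ : ∀ x ∈ Icc (0:ℝ) 1, |derivWithin y (Icc 0 1) x| ≤ Q)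
    (hf : ContDiffOn ℝ k fstar (Icc 0 1))
    (hb0 : fstar 0 = y 0) (hb1 : fstar 1 = y 1)
    (hmin : tikhonov M k α Ytil fstar ≤ tikhonov M k α Ytil y) :
    l2norm (iteratedDerivWithin k (fun x => fstar x - y x) (Icc 0 1))
      ≤ Real.sqrt (2 * deltaSq M N Ytil y / α
          + 2 * Q ^ 2 * (1 / M : ℝ) ^ 2 / (α * N ^ 2))
        + 2 * l2norm (iteratedDerivWithin k y (Icc 0 1)) := by
  have hM0 : 0 < M := by omega
  have hk1 : (1 : WithTop ℕ∞) ≤ k := by exact_mod_cast (by omega : 1 ≤ k)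
  have huniq : UniqueDiffOn ℝ (Icc (0:ℝ) 1) := uniqueDiffOn_Icc zero_lt_one
  have hQ0 : 0 ≤ Q := (abs_nonneg _).trans (hQ 0 (by simp))
  have hcy := hy.continuousOn_iteratedDerivWithin le_rfl huniq
  have hcf := hf.continuousOn_iteratedDerivWithin le_rfl huniq
  have hlip : ∀ a ∈ Icc (0:ℝ) 1, ∀ b ∈ Icc (0:ℝ) 1, |y b - y a| ≤ Q * |b - a| :=
    fun a ha b hb => (convex_Icc (0:ℝ) 1).norm_image_sub_le_of_norm_derivWithin_le
      (hy.differentiableOn (by intro h; simp [h] at hk1)) hQ ha hb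
  have hmis := misfit_le (Ytil := Ytil) hM0 fun i hi =>
    abs_groupMean_sub_intervalAvg_le (N := N) hM0 hN hy.continuousOn hQ0 hlip hi
  set F := l2norm (iteratedDerivWithin k fstar (Icc 0 1)) with hF
  set G := l2norm (iteratedDerivWithin k y (Icc 0 1)) with hG
  set C := 2 * deltaSq M N Ytil y / α + 2 * Q ^ 2 * (1 / M : ℝ) ^ 2 / (α * N ^ 2) with hC
  have hM' : (0:ℝ) < M := by exact_mod_cast hM0
  have hN' : (0:ℝ) < N := by exact_mod_cast hN
  have hG0 : 0 ≤ G := Real.sqrt_nonneg _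
  have hCα : α * C = 2 * deltaSq M N Ytil y + 2 * (Q / (M * N)) ^ 2 := by
    rw [hC]
    field_simp
  have hC0 : 0 ≤ C := by
    have : 0 ≤ deltaSq M N Ytil y := by unfold deltaSq; positivity
    positivity
  have hFG : F ^ 2 ≤ C + G ^ 2 := by
    have h0 : 0 ≤ (1 / M : ℝ) * ∑ i ∈ Finset.Icc 1 M, (Ytil i - intervalAvg M fstar i) ^ 2 := by
      positivity
    unfold tikhonov at hmin
    rw [← l2norm_sq, ← l2norm_sq, ← hF, ← hG] at hmin
    refine le_of_mul_le_mul_left ?_ hα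
    linarith
  have hFle : F ≤ √C + G := by
    refine (abs_le_of_sq_le_sq' ?_ (by positivity)).2
    nlinarith [Real.sq_sqrt hC0, mul_nonneg (Real.sqrt_nonneg C) hG0]
  have hsub : l2norm (iteratedDerivWithin k (fun x => fstar x - y x) (Icc 0 1))
      = l2norm (fun x => iteratedDerivWithin k fstar (Icc 0 1) x
          - iteratedDerivWithin k y (Icc 0 1) x) := by
    unfold l2norm
    congr 1
    refine intervalIntegral.integral_congr fun x hx => ?_
    rw [uIcc_of_le zero_le_one] at hx
    exact congrArg (· ^ 2) (iteratedDerivWithin_sub hx huniq (hf x hx) (hy x hx))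
  rw [hsub]
  linarith [l2norm_sub_le hcf hcy]
end

section
/- Let n ≥ 1 be an integer and let X be distributed according to the chi-squared distribution with n degrees of freedom. Then for every real a > 1, P(X ≥ a·n) ≤ (a·e^{1−a})^{n/2}; that is, χ²(n)({x ∈ ℝ : x ≥ a·n}) ≤ (a·e^{1−a})^{n/2}. -/
open MeasureTheory ProbabilityTheory

/-- The chi-squared distribution with `n` degrees of freedom: the Gamma distribution
with shape `n/2` and rate `1/2`. -/
noncomputable def chiSquaredMeasure (n : ℕ) : Measure ℝ :=
  gammaMeasure ((n : ℝ) / 2) (1 / 2)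

/-- Beyond `a` times its mean `k / r`, the gamma density is dominated by a multiple of the gamma
density whose rate is smaller by the factor `a`. -/
lemma gammaPDFReal_le_mul_gammaPDFReal_div {k r a x : ℝ} (hk : 0 < k) (hr : 0 < r) (ha : 1 ≤ a)
    (hx : a * (k / r) ≤ x) :
    gammaPDFReal k r x ≤ (a * Real.exp (1 - a)) ^ k * gammaPDFReal k (r / a) x := by
  have ha0 : 0 < a := by linarith
  have hx0 : 0 ≤ x := le_trans (by positivity) hx
  have hG := Real.Gamma_pos_of_pos hk
  have hak : 0 < a ^ k := Real.rpow_pos_of_pos ha0 k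
  have h_exponent : -(r * x) ≤ (1 - a) * k + -(r / a * x) := by
    have hmean : k ≤ r / a * x := by
      calc k = r / a * (a * (k / r)) := by field_simp
        _ ≤ r / a * x := by gcongr
    have hrx : r * x = a * (r / a * x) := by field_simp
    nlinarith [mul_nonneg (sub_nonneg.2 ha) (sub_nonneg.2 hmean)]
  rw [gammaPDFReal, gammaPDFReal, if_pos hx0, if_pos hx0,
    Real.mul_rpow ha0.le (Real.exp_pos _).le, ← Real.exp_mul, Real.div_rpow hr.le ha0.le]
  calc r ^ k / Real.Gamma k * x ^ (k - 1) * Real.exp (-(r * x))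
      ≤ r ^ k / Real.Gamma k * x ^ (k - 1) * Real.exp ((1 - a) * k + -(r / a * x)) := by gcongr
    _ = _ := by
      rw [Real.exp_add]
      field_simp

/-- Chernoff bound for the upper tail of the gamma distribution with shape `k` and rate `r`. -/
lemma gammaMeasure_tail_bound {k r a : ℝ} (hk : 0 < k) (hr : 0 < r) (ha : 1 ≤ a) :
    gammaMeasure k r {x : ℝ | a * (k / r) ≤ x}
      ≤ ENNReal.ofReal ((a * Real.exp (1 - a)) ^ k) := by
  have ha0 : 0 < a := by linarith
  have hmeas : MeasurableSet {x : ℝ | a * (k / r) ≤ x} := measurableSet_Ici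
  rw [gammaMeasure, withDensity_apply _ hmeas]
  calc ∫⁻ x in {x : ℝ | a * (k / r) ≤ x}, gammaPDF k r x
      ≤ ∫⁻ x in {x : ℝ | a * (k / r) ≤ x},
          ENNReal.ofReal ((a * Real.exp (1 - a)) ^ k) * gammaPDF k (r / a) x := by
        refine setLIntegral_mono' hmeas fun x hx ↦ ?_
        rw [gammaPDF, gammaPDF, ← ENNReal.ofReal_mul (by positivity)]
        exact ENNReal.ofReal_le_ofReal (gammaPDFReal_le_mul_gammaPDFReal_div hk hr ha hx)
    _ ≤ ∫⁻ x, ENNReal.ofReal ((a * Real.exp (1 - a)) ^ k) * gammaPDF k (r / a) x :=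
        setLIntegral_le_lintegral _ _
    _ = ENNReal.ofReal ((a * Real.exp (1 - a)) ^ k) := by
        rw [lintegral_const_mul' _ _ ENNReal.ofReal_ne_top,
          lintegral_gammaPDF_eq_one hk (by positivity), mul_one]

/-- Chernoff-type tail bound for the chi-squared distribution:
`P(X ≥ a·n) ≤ (a·e^{1−a})^{n/2}` for all `a > 1`. -/
theorem chiSquared_tail_bound (n : ℕ) (hn : 1 ≤ n) (a : ℝ) (ha : 1 < a) :
    chiSquaredMeasure n {x : ℝ | a * n ≤ x}
      ≤ ENNReal.ofReal ((a * Real.exp (1 - a)) ^ ((n : ℝ) / 2)) := by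
  have hn0 : (0 : ℝ) < n := by exact_mod_cast hn
  have h := gammaMeasure_tail_bound (k := (n : ℝ) / 2) (r := 1 / 2) (by positivity)
    (by norm_num) ha.le
  have hmean : (n : ℝ) / 2 / (1 / 2) = n := by ring
  rwa [hmean] at h
end

section
/- Let n ≥ 1 be an integer, let 0 < p < 1, and let z̄ ∈ (1, ∞) satisfy z̄·e^{1−z̄} = p^{2/n}. If X is distributed according to the chi-squared distribution with n degrees of freedom, then P(X ≥ z̄·n) ≤ p; equivalently, P(X ≤ z̄·n) ≥ 1 − p. -/
open MeasureTheory ProbabilityTheory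

/-- Comparison of the upper tail of a Gamma distribution with that of a Gamma distribution
of the same shape and a smaller rate. -/
theorem gammaMeasure_Ici_le_mul {a r s t : ℝ} (ha : 0 < a) (hs : 0 < s) (hsr : s ≤ r)
    (ht : 0 ≤ t) :
    gammaMeasure a r (Set.Ici t) ≤
      ENNReal.ofReal ((r / s) ^ a * Real.exp (-((r - s) * t))) *
        gammaMeasure a s (Set.Ici t) := by
  have hr : 0 < r := hs.trans_le hsr
  rw [gammaMeasure, gammaMeasure, withDensity_apply _ measurableSet_Ici,
    withDensity_apply _ measurableSet_Ici, ← lintegral_const_mul' _ _ ENNReal.ofReal_ne_top]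
  refine setLIntegral_mono' measurableSet_Ici fun x hx => ?_
  have htx : t ≤ x := hx
  have hx0 : 0 ≤ x := ht.trans htx
  rw [gammaPDF_of_nonneg hx0, gammaPDF_of_nonneg hx0,
    ← ENNReal.ofReal_mul (by positivity)]
  refine ENNReal.ofReal_le_ofReal ?_
  have hexp : Real.exp (-(r * x)) ≤ Real.exp (-((r - s) * t)) * Real.exp (-(s * x)) := by
    rw [← Real.exp_add, Real.exp_le_exp]
    nlinarith [mul_le_mul_of_nonneg_left htx (sub_nonneg.2 hsr)]
  have hG : 0 < Real.Gamma a := Real.Gamma_pos_of_pos ha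
  have hsa : 0 < s ^ a := Real.rpow_pos_of_pos hs a
  calc r ^ a / Real.Gamma a * x ^ (a - 1) * Real.exp (-(r * x))
      ≤ r ^ a / Real.Gamma a * x ^ (a - 1) *
          (Real.exp (-((r - s) * t)) * Real.exp (-(s * x))) :=
        mul_le_mul_of_nonneg_left hexp (by positivity)
    _ = (r / s) ^ a * Real.exp (-((r - s) * t)) *
          (s ^ a / Real.Gamma a * x ^ (a - 1) * Real.exp (-(s * x))) := by
        rw [Real.div_rpow hr.le hs.le]
        field_simp

/-- If `z̄ ∈ (1,∞)` solves `z̄·e^{1−z̄} = p^{2/n}`, then for `X ∼ χ²(n)`,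
`P(X ≥ z̄·n) ≤ p`; equivalently `P(X ≤ z̄·n) ≥ 1 − p`. -/
theorem chiSquared_quantile_bound (n : ℕ) (hn : 1 ≤ n) (p : ℝ) (hp0 : 0 < p)
    (hp1 : p < 1) (z : ℝ) (hz1 : 1 < z)
    (hze : z * Real.exp (1 - z) = p ^ ((2 : ℝ) / n)) :
    chiSquaredMeasure n {x : ℝ | z * n ≤ x} ≤ ENNReal.ofReal p ∧
    ENNReal.ofReal (1 - p) ≤ chiSquaredMeasure n {x : ℝ | x ≤ z * n} := by
  have hn0 : (0 : ℝ) < n := by exact_mod_cast hn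
  have hz0 : 0 < z := one_pos.trans hz1
  have ha : 0 < (n : ℝ) / 2 := by positivity
  have hs : 0 < 1 / (2 * z) := by positivity
  have hsr : 1 / (2 * z) ≤ 1 / 2 := one_div_le_one_div_of_le two_pos (by linarith)
  have hconst : (1 / 2 / (1 / (2 * z))) ^ ((n : ℝ) / 2) *
      Real.exp (-((1 / 2 - 1 / (2 * z)) * (z * n))) = p := by
    have h1 : 1 / 2 / (1 / (2 * z)) = z := by field_simp
    have h2 : -((1 / 2 - 1 / (2 * z)) * (z * n)) = (1 - z) * ((n : ℝ) / 2) := by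
      field_simp
      ring
    rw [h1, h2, Real.exp_mul, ← Real.mul_rpow hz0.le (Real.exp_pos _).le, hze,
      ← Real.rpow_mul hp0.le, div_mul_div_cancel₀ hn0.ne', div_self two_ne_zero, Real.rpow_one]
  have : IsProbabilityMeasure (gammaMeasure ((n : ℝ) / 2) (1 / (2 * z))) :=
    isProbabilityMeasure_gammaMeasure ha hs
  have : IsProbabilityMeasure (chiSquaredMeasure n) :=
    isProbabilityMeasure_gammaMeasure ha one_half_pos
  have htail : chiSquaredMeasure n (Set.Ici (z * n)) ≤ ENNReal.ofReal p := by
    have h := gammaMeasure_Ici_le_mul ha hs hsr (mul_nonneg hz0.le hn0.le)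
    rw [hconst] at h
    exact h.trans (mul_le_of_le_one_right' prob_le_one)
  refine ⟨htail, ?_⟩
  calc ENNReal.ofReal (1 - p) = 1 - ENNReal.ofReal p := by
        rw [ENNReal.ofReal_sub _ hp0.le, ENNReal.ofReal_one]
    _ ≤ 1 - chiSquaredMeasure n (Set.Ici (z * n)) := tsub_le_tsub_left htail 1
    _ = chiSquaredMeasure n (Set.Ici (z * n))ᶜ := (prob_compl_eq_one_sub measurableSet_Ici).symm
    _ ≤ chiSquaredMeasure n {x : ℝ | x ≤ z * n} :=
        measure_mono fun x hx => (not_le.1 (Set.mem_Ici.not.1 hx)).le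
end

section
/- Let M ≥ 1 be an integer. The pushforward of the M-fold product of the standard Gaussian measure N(0,1) on ℝ^M under the map (X_1,…,X_M) ↦ Σ_{i=1}^{M} X_i² is the chi-squared distribution with M degrees of freedom. -/
open MeasureTheory ProbabilityTheory

/-- Two probability measures on `ℝ` with the same moment-generating function, finite in a
neighbourhood of `0`, are equal. -/
lemma ext_of_mgf_id_eq {μ ν : Measure ℝ} [IsProbabilityMeasure μ] [IsProbabilityMeasure ν]
    (h : mgf id μ = mgf id ν) (h0 : 0 ∈ interior (integrableExpSet id μ)) : μ = ν := by
  apply Measure.ext_of_charFun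
  ext t
  rw [← complexMGF_id_mul_I, ← complexMGF_id_mul_I]
  exact eqOn_complexMGF_of_mgf h (by simpa using h0)

lemma mgf_gammaMeasure_eq_setIntegral {a r : ℝ} (ha : 0 < a) (hr : 0 < r) (t : ℝ) :
    mgf id (gammaMeasure a r) t =
      r ^ a / Real.Gamma a * ∫ x in Set.Ioi 0, x ^ (a - 1) * Real.exp (-((r - t) * x)) := by
  have hmeas : Measurable (gammaPDF a r) := (measurable_gammaPDFReal a r).ennreal_ofReal
  rw [mgf, gammaMeasure, integral_withDensity_eq_integral_toReal_smul hmeas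
    (ae_of_all _ fun _ ↦ ENNReal.ofReal_lt_top),
    ← integral_const_mul, ← integral_Ici_eq_integral_Ioi, ← integral_indicator measurableSet_Ici]
  congr 1 with x
  rw [gammaPDF, ENNReal.toReal_ofReal (gammaPDFReal_nonneg ha hr x), gammaPDFReal]
  by_cases hx : 0 ≤ x
  · rw [if_pos hx, Set.indicator_of_mem (Set.mem_Ici.2 hx), smul_eq_mul, id,
      mul_assoc _ (Real.exp _), ← Real.exp_add, mul_assoc]
    ring_nf
  · simp [hx]

/-- The moment-generating function of the Gamma distribution below its rate. -/
lemma mgf_gammaMeasure_of_lt {a r t : ℝ} (ha : 0 < a) (hr : 0 < r) (ht : t < r) :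
    mgf id (gammaMeasure a r) t = (r / (r - t)) ^ a := by
  have hrt : 0 < r - t := sub_pos.2 ht
  rw [mgf_gammaMeasure_eq_setIntegral ha hr, Real.integral_rpow_mul_exp_neg_mul_Ioi ha hrt,
    Real.div_rpow hr.le hrt.le, Real.div_rpow zero_le_one hrt.le, Real.one_rpow]
  have := (Real.Gamma_pos_of_pos ha).ne'
  field_simp

/-- The exponential moments of the Gamma distribution diverge from its rate on, so that the
moment-generating function takes its default value there. -/
lemma mgf_gammaMeasure_of_le {a r t : ℝ} (ha : 0 < a) (hr : 0 < r) (ht : r ≤ t) :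
    mgf id (gammaMeasure a r) t = 0 := by
  rw [mgf_gammaMeasure_eq_setIntegral ha hr, integral_undef, mul_zero]
  intro hint
  refine not_integrableOn_Ioi_rpow (a - 1) (hint.mono (by fun_prop) ?_)
  filter_upwards [ae_restrict_mem measurableSet_Ioi] with x (hx : 0 < x)
  rw [norm_mul]
  refine le_mul_of_one_le_right (norm_nonneg _) ?_
  rw [Real.norm_eq_abs, Real.abs_exp]
  exact Real.one_le_exp (by nlinarith)

lemma mgf_sq_gaussianReal (t : ℝ) :
    mgf (fun x ↦ x ^ 2) (gaussianReal 0 1) t = √((1 / 2) / (1 / 2 - t)) := by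
  rw [mgf, integral_gaussianReal_eq_integral_smul one_ne_zero]
  have h (x : ℝ) : gaussianPDFReal 0 1 x • Real.exp (t * x ^ 2) =
      (√(2 * Real.pi))⁻¹ * Real.exp (-(1 / 2 - t) * x ^ 2) := by
    rw [gaussianPDFReal, smul_eq_mul, mul_assoc, ← Real.exp_add]
    simp only [NNReal.coe_one, mul_one]
    ring_nf
  simp_rw [h]
  rw [integral_const_mul, integral_gaussian, ← Real.sqrt_inv, ← Real.sqrt_mul (by positivity)]
  congr 1
  field_simp

lemma mgf_sumSq_pi_gaussianReal {ι : Type*} [Fintype ι] (t : ℝ) :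
    mgf (fun X : ι → ℝ ↦ ∑ i, X i ^ 2) (Measure.pi fun _ ↦ gaussianReal 0 1) t =
      √((1 / 2) / (1 / 2 - t)) ^ Fintype.card ι := by
  rw [← mgf_sq_gaussianReal, mgf, mgf, ← integral_fintype_prod_eq_pow]
  simp_rw [Finset.mul_sum, Real.exp_sum]

/-- The sum of squares of `M` iid standard Gaussians is chi-squared with `M` degrees
of freedom: the pushforward of the `M`-fold product of `N(0,1)` under
`(X_1,…,X_M) ↦ ∑ X_i²` is the Gamma distribution with shape `M/2` and rate `1/2`. -/
theorem sumSq_gaussian_chiSquared (M : ℕ) (hM : 1 ≤ M) :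
    Measure.map (fun X : Fin M → ℝ => ∑ i, (X i) ^ 2)
      (Measure.pi fun _ : Fin M => gaussianReal 0 1)
      = gammaMeasure ((M : ℝ) / 2) (1 / 2) := by
  have ha : (0 : ℝ) < M / 2 := by positivity
  have hr : (0 : ℝ) < 1 / 2 := by norm_num
  have hmeas : Measurable fun X : Fin M → ℝ ↦ ∑ i, X i ^ 2 := by fun_prop
  have := isProbabilityMeasure_gammaMeasure ha hr
  have := Measure.isProbabilityMeasure_map
    (μ := Measure.pi fun _ : Fin M ↦ gaussianReal 0 1) hmeas.aemeasurable
  symm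
  refine ext_of_mgf_id_eq ?_ ?_
  · ext t
    rw [mgf_id_map hmeas.aemeasurable, mgf_sumSq_pi_gaussianReal, Fintype.card_fin]
    rcases lt_or_ge t (1 / 2) with ht | ht
    · rw [mgf_gammaMeasure_of_lt ha hr ht, Real.sqrt_eq_rpow, ← Real.rpow_natCast,
        ← Real.rpow_mul (div_nonneg hr.le (sub_nonneg.2 ht.le))]
      ring_nf
    · rw [mgf_gammaMeasure_of_le ha hr ht, Real.sqrt_eq_zero_of_nonpos
        (div_nonpos_of_nonneg_of_nonpos hr.le (sub_nonpos.2 ht)), zero_pow (by lia)]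
  · refine mem_interior.2 ⟨Set.Iio (1 / 2), fun t (ht : t < 1 / 2) ↦ ?_, isOpen_Iio, hr⟩
    by_contra hint
    have h := mgf_gammaMeasure_of_lt ha hr ht
    rw [mgf_undef hint] at h
    exact (Real.rpow_pos_of_pos (div_pos hr (sub_pos.2 ht)) _).ne h
end
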